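/- arXiv:1102.1681 — 2 statements merged into one kernel-verified Lean document; each statement's English description precedes it below -/
import Mathlib

section
/- Let τ > ω be a cardinal. Any closed, C-embedded, Lindelöf subset of ℝ^τ is a Z_τ-set in ℝ^τ. -/
open Set Topology

universe u

/-- A subset `U` of a topological space is functionally open (a cozero set). -/
def FunctionallyOpen {X : Type*} [TopologicalSpace X] (U : Set X) : Prop :=
  ∃ φ : X → ℝ, Continuous φ ∧ U = φ ⁻¹' {(0 : ℝ)}ᶜ

/-- A countable cover by functionally open sets. -/
def IsCFOCover {X : Type*} [TopologicalSpace X] (𝒰 : Set (Set X)) : Prop :=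
  𝒰.Countable ∧ (∀ U ∈ 𝒰, FunctionallyOpen U) ∧ ⋃₀ 𝒰 = Set.univ

/-- Two maps are `𝒰`-close if every point's images lie in a common member of `𝒰`. -/
def UClose {X Y : Type*} (𝒰 : Set (Set Y)) (f g : X → Y) : Prop :=
  ∀ x, ∃ U ∈ 𝒰, f x ∈ U ∧ g x ∈ U

/-- Two sets are functionally separated if some continuous `[0,1]`-valued function
is `0` on the first and `1` on the second. -/
def FunctionallySeparated {X : Type*} [TopologicalSpace X] (P Q : Set X) : Prop :=
  ∃ φ : X → ℝ, Continuous φ ∧ (∀ x, φ x ∈ Set.Icc (0 : ℝ) 1) ∧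
    (∀ p ∈ P, φ p = 0) ∧ (∀ q ∈ Q, φ q = 1)

/-- `Z` is a `Z_τ`-set in `X`: the self-maps of `X` whose image is functionally separated
from `Z` are dense in the `τ`-limitation topology on `C(X, X)`. -/
def ZTauSet {X : Type u} [TopologicalSpace X] (τ : Cardinal.{u}) (Z : Set X) : Prop :=
  IsClosed Z ∧ ∀ g : X → X, Continuous g →
    ∀ 𝒞 : Set (Set (Set X)), Cardinal.mk ↥𝒞 < τ → (∀ 𝒰 ∈ 𝒞, IsCFOCover 𝒰) →
      ∃ f : X → X, Continuous f ∧ (∀ 𝒰 ∈ 𝒞, UClose 𝒰 f g) ∧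
        FunctionallySeparated (Set.range f) Z

/-- A subset is C-embedded if every continuous real-valued function on it extends
continuously to the whole space. -/
def CEmbedded {X : Type*} [TopologicalSpace X] (Z : Set X) : Prop :=
  ∀ φ : ↥Z → ℝ, Continuous φ → ∃ ψ : X → ℝ, Continuous ψ ∧ ∀ z : ↥Z, ψ (z : X) = φ z


/-- The basic open subset of a power of `X` cut out by finitely many coordinate conditions taken
from the countable basis of `X`. -/
def basicBox {ι X : Type*} [TopologicalSpace X] [SecondCountableTopology X]
    (s : Finset (ι × TopologicalSpace.countableBasis X)) : Set (ι → X) :=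
  {x | ∀ p ∈ s, x p.1 ∈ (p.2 : Set X)}

section CountableDependence

variable {ι X : Type*} [TopologicalSpace X] [SecondCountableTopology X]

open TopologicalSpace

lemma isOpen_basicBox (s : Finset (ι × countableBasis X)) : IsOpen (basicBox s) := by
  have : basicBox s = ⋂ p ∈ s, (fun x : ι → X => x p.1) ⁻¹' (p.2 : Set X) := by
    ext x; simp [basicBox]
  rw [this]
  exact isOpen_biInter_finset fun p _ =>
    (isOpen_of_mem_countableBasis p.2.2).preimage (continuous_apply p.1)

lemma exists_basicBox_subset {U : Set (ι → X)} (hU : IsOpen U) {x : ι → X} (hx : x ∈ U) :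
    ∃ s : Finset (ι × countableBasis X), x ∈ basicBox s ∧ basicBox s ⊆ U := by
  classical
  obtain ⟨I, u, hu, hsub⟩ := isOpen_pi_iff.1 hU x hx
  have key : ∀ i : I, ∃ v : countableBasis X, x i ∈ (v : Set X) ∧ (v : Set X) ⊆ u i := fun i => by
    obtain ⟨v, hv, hxv, hvu⟩ :=
      (isBasis_countableBasis X).exists_subset_of_mem_open (hu i i.2).2 (hu i i.2).1
    exact ⟨⟨v, hv⟩, hxv, hvu⟩
  choose v hxv hvu using key
  refine ⟨I.attach.image fun i : I => ((i : ι), v i), ?_, fun y hy => hsub fun i hi => ?_⟩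
  · intro p hp
    obtain ⟨i, -, rfl⟩ := Finset.mem_image.1 hp
    exact hxv i
  · exact hvu ⟨i, hi⟩ (hy _ (Finset.mem_image_of_mem _ (Finset.mem_attach I ⟨i, hi⟩)))

lemma countable_setOf_support_subset {D : Set ι} (hD : D.Countable) :
    {s : Finset (ι × countableBasis X) | ∀ p ∈ s, p.1 ∈ D}.Countable := by
  have h : {t : Set (ι × countableBasis X) | t.Finite ∧ t ⊆ D ×ˢ univ}.Countable :=
    countable_ofPred_finite_subset (hD.prod countable_univ)
  refine (h.preimage Finset.coe_injective).mono fun s hs => ?_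
  exact ⟨s.finite_toSet, fun p hp => ⟨hs p hp, mem_univ _⟩⟩

/-- Closing off a countable set of coordinates under a map on finite sets of conditions. -/
lemma exists_countable_closed_support
    (F : Finset (ι × countableBasis X) → Finset (ι × countableBasis X)) :
    ∃ D : Set ι, D.Countable ∧
      ∀ s, (∀ p ∈ s, p.1 ∈ D) → ∀ p ∈ F s, p.1 ∈ D := by
  let step : Set ι → Set ι := fun D =>
    D ∪ ⋃ s ∈ {s : Finset (ι × countableBasis X) | ∀ p ∈ s, p.1 ∈ D},
      Prod.fst '' (F s : Set (ι × countableBasis X))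
  let D : ℕ → Set ι := fun n => step^[n] ∅
  have hsucc : ∀ n, D (n + 1) = step (D n) := fun n => Function.iterate_succ_apply' _ _ _
  have hmono : Monotone D := monotone_nat_of_le_succ fun n => by
    rw [hsucc]; exact subset_union_left
  have hcount : ∀ n, (D n).Countable := by
    intro n
    induction n with
    | zero => exact countable_empty
    | succ n ih =>
      rw [hsucc]
      exact ih.union ((countable_setOf_support_subset ih).biUnion fun s _ =>
        ((F s).countable_toSet).image _)
  refine ⟨⋃ n, D n, countable_iUnion hcount, fun s hs p hp => ?_⟩
  have : ∃ n, ∀ q ∈ s, q.1 ∈ D n := by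
    choose! n hn using fun q hq => mem_iUnion.1 (hs q hq)
    exact ⟨s.sup n, fun q hq => hmono (Finset.le_sup hq) (hn q hq)⟩
  obtain ⟨n, hn⟩ := this
  refine mem_iUnion.2 ⟨n + 1, ?_⟩
  rw [hsucc]
  exact Or.inr (mem_biUnion (show s ∈ {s | ∀ p ∈ s, p.1 ∈ D n} from hn) ⟨p, hp, rfl⟩)

/-- The closure of an open subset of a power of a second countable space depends only on countably
many coordinates. -/
lemma exists_countable_closure_dependsOn {U : Set (ι → X)} (hU : IsOpen U) :
    ∃ D : Set ι, D.Countable ∧ DependsOn (· ∈ closure U) D := by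
  classical
  have hF : ∀ s : Finset (ι × countableBasis X), ∃ t : Finset (ι × countableBasis X),
      (U ∩ basicBox s).Nonempty → (basicBox t).Nonempty ∧ basicBox t ⊆ U ∩ basicBox s := by
    intro s
    by_cases h : (U ∩ basicBox s).Nonempty
    · obtain ⟨x, hx⟩ := h
      obtain ⟨t, hxt, ht⟩ := exists_basicBox_subset (hU.inter (isOpen_basicBox s)) hx
      exact ⟨t, fun _ => ⟨⟨x, hxt⟩, ht⟩⟩
    · exact ⟨∅, fun h' => absurd h' h⟩
  choose F hF using hF
  obtain ⟨D, hD, hclosed⟩ := exists_countable_closed_support F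
  have key : ∀ x y : ι → X, (∀ i ∈ D, x i = y i) → x ∈ closure U → y ∈ closure U := by
    intro x y hxy hx
    refine mem_closure_iff.2 fun V hV hyV => ?_
    obtain ⟨s, hys, hsV⟩ := exists_basicBox_subset hV hyV
    let s' := s.filter fun p => p.1 ∈ D
    have hs' : ∀ p ∈ s', p.1 ∈ D := fun p hp => (Finset.mem_filter.1 hp).2
    have hxs' : x ∈ basicBox s' := fun p hp => by
      rw [hxy _ (hs' p hp)]
      exact hys p (Finset.mem_filter.1 hp).1
    obtain ⟨z, hzs', hzU⟩ := mem_closure_iff.1 hx _ (isOpen_basicBox s') hxs'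
    obtain ⟨⟨w, hw⟩, hsub⟩ := hF s' ⟨z, hzU, hzs'⟩
    let v : ι → X := fun i => if i ∈ D then w i else y i
    have hv : v ∈ basicBox (F s') := fun p hp => by
      simpa [v, hclosed s' hs' p hp] using hw p hp
    refine ⟨v, hsV fun p hp => ?_, (hsub hv).1⟩
    by_cases hpD : p.1 ∈ D
    · exact (hsub hv).2 p (Finset.mem_filter.2 ⟨hp, hpD⟩)
    · simpa [v, hpD] using hys p hp
  exact ⟨D, hD, fun x y hxy =>
    propext ⟨key x y hxy, key y x fun i hi => (hxy i hi).symm⟩⟩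

/-- A continuous real-valued function on a power of a second countable space depends only on
countably many coordinates. -/
theorem Continuous.exists_countable_dependsOn {φ : (ι → X) → ℝ} (hφ : Continuous φ) :
    ∃ D : Set ι, D.Countable ∧ DependsOn φ D := by
  have h (a : ℚ) := exists_countable_closure_dependsOn
    (isOpen_lt hφ (continuous_const (y := (a : ℝ))))
  choose D hD hdep using h
  have key : ∀ x y : ι → X, (∀ i ∈ ⋃ a, D a, x i = y i) → φ y ≤ φ x := by
    intro x y hxy
    by_contra! hlt
    obtain ⟨a, hxa, hay⟩ := exists_rat_btwn hlt
    have hy : y ∈ closure {z | φ z < a} :=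
      (hdep a fun i hi => hxy i (mem_iUnion_of_mem a hi)).mp (subset_closure hxa)
    have : φ y ≤ a := closure_lt_subset_le hφ continuous_const hy
    exact this.not_gt hay
  exact ⟨⋃ a, D a, countable_iUnion hD, fun x y hxy =>
    le_antisymm (key y x fun i hi => (hxy i hi).symm) (key x y hxy)⟩

end CountableDependence

lemma FunctionallyOpen.iUnion {X ι : Type*} [TopologicalSpace X] [Countable ι] {U : ι → Set X}
    (hU : ∀ i, FunctionallyOpen (U i)) : FunctionallyOpen (⋃ i, U i) := by
  choose φ hφ hUφ using hU
  obtain ⟨_⟩ := nonempty_encodable ι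
  let ψ : ι → X → ℝ := fun i x => (1 / 2) ^ Encodable.encode i * min 1 |φ i x|
  have hnonneg : ∀ i x, 0 ≤ ψ i x := fun i x => by positivity
  have hbound : ∀ i x, ψ i x ≤ (1 / 2) ^ Encodable.encode i := fun i x =>
    mul_le_of_le_one_right (by positivity) (min_le_left _ _)
  have hsummable := summable_geometric_two_encode (ι := ι)
  have hψ : ∀ x, Summable fun i => ψ i x := fun x =>
    hsummable.of_nonneg_of_le (fun i => hnonneg i x) fun i => hbound i x
  refine ⟨fun x => ∑' i, ψ i x, continuous_tsum (fun i => ?_) hsummable fun i x => ?_, ?_⟩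
  · have := hφ i
    fun_prop
  · rw [Real.norm_of_nonneg (hnonneg i x)]
    exact hbound i x
  · ext x
    have hiff : ∑' i, ψ i x = 0 ↔ ∀ i, φ i x = 0 := by
      rw [← (hψ x).hasSum_iff, hasSum_zero_iff_of_nonneg fun i => hnonneg i x, funext_iff]
      refine forall_congr' fun i => ?_
      have : min 1 |φ i x| = 0 ↔ φ i x = 0 := by
        rw [← abs_eq_zero (a := φ i x)]
        constructor <;> intro h <;> rcases min_cases 1 |φ i x| with h' | h' <;> linarith
      simpa [ψ] using this
    simp [hUφ, hiff]

/-- A C-embedded set is functionally separated from every set missing some functionally open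
neighbourhood of it. -/
lemma CEmbedded.functionallySeparated {X : Type*} [TopologicalSpace X] {P U Z : Set X}
    (hZ : CEmbedded Z) (hU : FunctionallyOpen U) (hZU : Z ⊆ U) (hPU : Disjoint P U) :
    FunctionallySeparated P Z := by
  obtain ⟨φ, hφ, rfl⟩ := hU
  obtain ⟨ψ, hψ, hext⟩ := hZ (fun z => (φ z)⁻¹)
    ((hφ.comp continuous_subtype_val).inv₀ fun z => hZU z.2)
  refine ⟨fun x => max 0 (min 1 (φ x * ψ x)), by fun_prop, fun x => ⟨by simp, by simp⟩, ?_, ?_⟩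
  · intro p hp
    have : φ p = 0 := by simpa using disjoint_left.1 hPU hp
    simp [this]
  · intro z hz
    have : φ z * ψ z = 1 := by rw [hext ⟨z, hz⟩]; exact mul_inv_cancel₀ (hZU hz)
    simp [this]

/-- Closeness to a countable functionally open cover of a power of `ℝ` is guaranteed by agreement
on a suitable countable set of coordinates. -/
lemma IsCFOCover.exists_countable_uClose {A : Type*} {𝒰 : Set (Set (A → ℝ))} (h𝒰 : IsCFOCover 𝒰) :
    ∃ D : Set A, D.Countable ∧
      ∀ f g : (A → ℝ) → (A → ℝ), (∀ x, ∀ a ∈ D, f x a = g x a) → UClose 𝒰 f g := by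
  obtain ⟨hcount, hopen, hcover⟩ := h𝒰
  have h : ∀ U ∈ 𝒰, ∃ D : Set A, D.Countable ∧ DependsOn (· ∈ U) D := fun U hU => by
    obtain ⟨φ, hφ, rfl⟩ := hopen U hU
    obtain ⟨D, hD, hdep⟩ := hφ.exists_countable_dependsOn
    exact ⟨D, hD, fun x y hxy => by simp [hdep hxy]⟩
  choose! D hD hdep using h
  refine ⟨⋃ U ∈ 𝒰, D U, hcount.biUnion hD, fun f g hfg x => ?_⟩
  obtain ⟨U, hU, hgU⟩ := mem_sUnion.1 (hcover ▸ mem_univ (g x))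
  exact ⟨U, hU, (hdep U hU fun a ha => hfg x a (mem_biUnion hU ha)).mpr hgU, hgU⟩

/-- A Lindelöf set in a power of `ℝ` can be covered by a functionally open set that is avoided by
every point taking some prescribed values on a countable subset of a given uncountable set of
coordinates. -/
lemma IsLindelof.exists_functionallyOpen_avoiding {A : Type*} {Z : Set (A → ℝ)} (hZ : IsLindelof Z)
    {C : Set A} (hC : ¬ C.Countable) :
    ∃ U : Set (A → ℝ), FunctionallyOpen U ∧ Z ⊆ U ∧ ∃ D ⊆ C, ∃ e : A → ℝ,
      ∀ x : A → ℝ, (∀ a ∈ D, x a = e a) → x ∉ U := by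
  let W : {p : A × A // p.1 ∈ C ∧ p.2 ∈ C ∧ p.1 ≠ p.2} → Set (A → ℝ) :=
    fun p => {x | |x p.1.1 - x p.1.2| < 1}
  have hW : ∀ p, FunctionallyOpen (W p) := fun p =>
    ⟨fun x => max 0 (1 - |x p.1.1 - x p.1.2|), by fun_prop, by
      ext x; simp [W]⟩
  have hWopen : ∀ p, IsOpen (W p) := fun p => isOpen_lt (by fun_prop) continuous_const
  have hcover : Z ⊆ ⋃ p, W p := fun x _ => by
    have : ¬ InjOn (fun a => ⌊x a⌋) C := fun h =>
      hC ((mapsTo_univ _ C).countable_of_injOn h countable_univ)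
    simp only [InjOn, not_forall] at this
    obtain ⟨c, hc, d, hd, hcd, hne⟩ := this
    exact mem_iUnion.2 ⟨⟨(c, d), hc, hd, hne⟩, Int.abs_sub_lt_one_of_floor_eq_floor hcd⟩
  obtain ⟨r, hr, hZr⟩ := hZ.elim_countable_subcover W hWopen hcover
  have := hr.to_subtype
  let D : Set A := (⋃ p ∈ r, {p.1.1}) ∪ ⋃ p ∈ r, {p.1.2}
  have hD : D.Countable := (hr.biUnion fun _ _ => countable_singleton _).union
    (hr.biUnion fun _ _ => countable_singleton _)
  obtain ⟨e, he⟩ := countable_iff_exists_injOn.1 hD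
  refine ⟨⋃ p : r, W p, .iUnion fun p => hW p, by rwa [← biUnion_eq_iUnion r fun p _ => W p],
    D, ?_, fun a => e a, ?_⟩
  · rintro a (ha | ha)
    · obtain ⟨p, -, rfl⟩ := mem_iUnion₂.1 ha
      exact p.2.1
    · obtain ⟨p, -, rfl⟩ := mem_iUnion₂.1 ha
      exact p.2.2.1
  · intro x hx hxU
    obtain ⟨⟨p, hp⟩, hxp⟩ := mem_iUnion.1 hxU
    have h₁ : p.1.1 ∈ D := Or.inl (mem_biUnion hp rfl)
    have h₂ : p.1.2 ∈ D := Or.inr (mem_biUnion hp rfl)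
    have hlt : |x p.1.1 - x p.1.2| < 1 := hxp
    rw [hx _ h₁, hx _ h₂] at hlt
    beta_reduce at hlt
    have : |((e p.1.1 : ℤ) - (e p.1.2 : ℤ) : ℤ)| < 1 := by exact_mod_cast hlt
    rw [Int.abs_lt_one_iff, sub_eq_zero, Nat.cast_inj] at this
    exact p.2.2.2 (he h₁ h₂ this)

lemma Cardinal.not_countable_compl_of_mk_lt {A : Type u} {B : Set A}
    (hA : Cardinal.aleph0 < Cardinal.mk A) (hB : Cardinal.mk B < Cardinal.mk A) :
    ¬ Bᶜ.Countable := fun h => by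
  have : Cardinal.mk B + Cardinal.mk (Bᶜ : Set A) < Cardinal.mk A :=
    Cardinal.add_lt_of_lt hA.le hB ((Cardinal.le_aleph0_iff_set_countable.2 h).trans_lt hA)
  exact this.ne (Cardinal.mk_sum_compl B)

/-- For `τ > ω`, every closed, C-embedded, Lindelöf subset of `ℝ^τ` is a `Z_τ`-set. -/
theorem lindelof_C_embedded_is_Z_tau
    (τ : Cardinal.{u}) (hτ : Cardinal.aleph0 < τ)
    (A : Type u) (hA : Cardinal.mk A = τ)
    (Z : Set (A → ℝ)) (hZcl : IsClosed Z) (hZC : CEmbedded Z) (hZL : IsLindelof Z) :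
    ZTauSet τ Z := by
  classical
  refine ⟨hZcl, fun g hg 𝒞 h𝒞 hcov => ?_⟩
  choose D hD hclose using fun 𝒰 : 𝒞 => (hcov 𝒰 𝒰.2).exists_countable_uClose
  have hB : Cardinal.mk (⋃ 𝒰, D 𝒰) < Cardinal.mk A := by
    rw [hA]
    refine (Cardinal.mk_iUnion_le D).trans_lt (Cardinal.mul_lt_of_lt hτ.le h𝒞 ?_)
    exact (ciSup_le' fun 𝒰 => Cardinal.le_aleph0_iff_set_countable.2 (hD 𝒰)).trans_lt hτ
  obtain ⟨U, hU, hZU, E, hE, e, he⟩ :=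
    hZL.exists_functionallyOpen_avoiding (Cardinal.not_countable_compl_of_mk_lt (hA ▸ hτ) hB)
  refine ⟨fun x a => if a ∈ E then e a else g x a, continuous_pi fun a => ?_, fun 𝒰 h𝒰 => ?_,
    hZC.functionallySeparated hU hZU (disjoint_left.2 ?_)⟩
  · by_cases ha : a ∈ E
    · simpa [ha] using continuous_const
    · simp only [ha, if_false]
      exact (continuous_apply a).comp hg
  · refine hclose ⟨𝒰, h𝒰⟩ _ g fun x a ha => if_neg fun haE => hE haE ?_
    exact mem_iUnion_of_mem _ ha
  · rintro _ ⟨x, rfl⟩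
    exact he _ fun a ha => if_pos ha
end

section
/- Let τ > ω be a cardinal. Any homeomorphism h : Z → F between closed, C-embedded, Lindelöf subsets Z and F of ℝ^τ can be extended to a homeomorphism H : ℝ^τ → ℝ^τ (i.e. H|Z = h). -/
open Set Topology

universe u

/-- On a Lindelöf subset of `ℝ^A`, a continuous function depends on countably many coordinates. -/
lemma IsLindelof.exists_countable_eqOn {A : Type*} {S : Set (A → ℝ)} (hS : IsLindelof S)
    {φ : (A → ℝ) → ℝ} (hφ : Continuous φ) :
    ∃ D : Set A, D.Countable ∧ ∀ x ∈ S, ∀ y, EqOn x y D → φ x = φ y := by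
  have key : ∀ n : ℕ, ∃ D : Set A, D.Countable ∧
      ∀ x ∈ S, ∀ y, EqOn x y D → |φ x - φ y| < 1 / (n + 1 : ℝ) := by
    intro n
    have hε : (0 : ℝ) < 1 / (n + 1 : ℝ) / 2 := by positivity
    have box : ∀ x : A → ℝ, ∃ (I : Finset A) (t : A → Set ℝ), (∀ i, IsOpen (t i) ∧ x i ∈ t i) ∧
        (I : Set A).pi t ⊆ φ ⁻¹' Metric.ball (φ x) (1 / (n + 1 : ℝ) / 2) := by
      intro x
      have hm : φ ⁻¹' Metric.ball (φ x) (1 / (n + 1 : ℝ) / 2) ∈ 𝓝 x :=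
        hφ.continuousAt (Metric.ball_mem_nhds _ hε)
      rw [nhds_pi, Filter.mem_pi'] at hm
      obtain ⟨I, t, ht, hsub⟩ := hm
      refine ⟨I, fun i ↦ interior (t i), fun i ↦ ⟨isOpen_interior, mem_interior_iff_mem_nhds.2 (ht i)⟩,
        fun y hy ↦ hsub fun i hi ↦ interior_subset (hy i hi)⟩
    choose I t ht hsub using box
    obtain ⟨r, hr, hcov⟩ := hS.elim_countable_subcover (fun x ↦ (I x : Set A).pi (t x))
      (fun x ↦ isOpen_set_pi (I x).finite_toSet fun i _ ↦ (ht x i).1)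
      (fun x _ ↦ mem_iUnion.2 ⟨x, fun i _ ↦ (ht x i).2⟩)
    refine ⟨⋃ x ∈ r, (I x : Set A), hr.biUnion fun x _ ↦ (I x).countable_toSet, ?_⟩
    intro x hx y hxy
    obtain ⟨w, hw, hxw⟩ := mem_iUnion₂.1 (hcov hx)
    have hyw : y ∈ (I w : Set A).pi (t w) := fun i hi ↦
      hxy (mem_iUnion₂.2 ⟨w, hw, hi⟩) ▸ hxw i hi
    have h1 : dist (φ x) (φ w) < _ := hsub w hxw
    have h2 : dist (φ y) (φ w) < _ := hsub w hyw
    have := dist_triangle_right (φ x) (φ y) (φ w)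
    rw [← Real.dist_eq]
    linarith
  choose D hD hφD using key
  refine ⟨⋃ n, D n, countable_iUnion hD, fun x hx y hxy ↦ ?_⟩
  by_contra hne
  obtain ⟨n, hn⟩ := exists_nat_one_div_lt (abs_pos.2 (sub_ne_zero.2 hne))
  exact (hφD n x hx y (hxy.mono (subset_iUnion D n))).not_gt hn

/-- The points of finite support form a Lindelöf (in fact σ-compact) subset of `ℝ^A`. -/
lemma isLindelof_setOf_finite_support (A : Type*) :
    IsLindelof {x : A → ℝ | (Function.support x).Finite} := by
  classical
  let K : ℕ × ℕ → Set (A → ℝ) := fun q ↦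
    (univ.pi fun _ ↦ Icc (-(q.2 : ℝ)) q.2) ∩
      ⋂ (T : Finset A) (_ : T.card = q.1 + 1), ⋃ a ∈ T, {x | x a = 0}
  have hK : ∀ q, IsCompact (K q) := fun q ↦
    (isCompact_univ_pi fun _ ↦ isCompact_Icc).inter_right <|
      isClosed_iInter fun T ↦ isClosed_iInter fun _ ↦ T.finite_toSet.isClosed_biUnion fun a _ ↦
        isClosed_eq (continuous_apply a) continuous_const
  have hEq : {x : A → ℝ | (Function.support x).Finite} = ⋃ q, K q := by
    ext x
    simp only [mem_ofPred_eq, mem_iUnion]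
    constructor
    · intro hx
      obtain ⟨m, hm⟩ := exists_nat_ge (∑ a ∈ hx.toFinset, |x a|)
      refine ⟨(hx.toFinset.card, m), fun a _ ↦ ?_, ?_⟩
      · rw [mem_Icc, ← abs_le]
        by_cases ha : x a = 0
        · simp [ha]
        · exact (Finset.single_le_sum (f := fun a ↦ |x a|) (fun _ _ ↦ abs_nonneg _)
            (hx.mem_toFinset.2 ha)).trans hm
      · simp only [mem_iInter, mem_iUnion]
        intro T hT
        by_contra! hcon
        have : T ⊆ hx.toFinset := fun a ha ↦ hx.mem_toFinset.2 (hcon a ha)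
        have := Finset.card_le_card this
        omega
    · rintro ⟨⟨n, m⟩, -, hx⟩
      simp only [mem_iInter, mem_iUnion] at hx
      by_contra hinf
      obtain ⟨T, hTs, hT⟩ := Set.Infinite.exists_subset_card_eq hinf (n + 1)
      obtain ⟨a, ha, ha0⟩ := hx T hT
      exact hTs ha ha0
  rw [hEq]
  exact isLindelof_iUnion fun q ↦ (hK q).isLindelof

/-- A continuous real function on `ℝ^A` depends on countably many coordinates. -/
lemma Continuous.exists_countable_eqOn {A : Type*} {φ : (A → ℝ) → ℝ} (hφ : Continuous φ) :
    ∃ D : Set A, D.Countable ∧ ∀ x y, EqOn x y D → φ x = φ y := by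
  classical
  obtain ⟨D, hD, hφD⟩ := (isLindelof_setOf_finite_support A).exists_countable_eqOn hφ
  refine ⟨D, hD, fun x y hxy ↦ ?_⟩
  let cut : (A → ℝ) → Finset A → A → ℝ := fun x I a ↦ if a ∈ I then x a else 0
  have hcut : ∀ x, Filter.Tendsto (cut x) Filter.atTop (𝓝 x) := by
    intro x
    refine tendsto_pi_nhds.2 fun a ↦ tendsto_const_nhds.congr' ?_
    filter_upwards [Filter.eventually_ge_atTop {a}] with I hI
    simp [cut, Finset.singleton_subset_iff.1 hI]
  refine tendsto_nhds_unique ((hφ.tendsto x).comp (hcut x)) ?_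
  refine ((hφ.tendsto y).comp (hcut y)).congr fun I ↦ (hφD _ ?_ _ ?_).symm
  · exact I.finite_toSet.subset fun a ha ↦ by
      by_contra h
      exact ha (if_neg h)
  · intro a ha
    simp [cut, hxy ha]

/-- A Lindelöf subset of `ℝ^A` misses a full fibre of the projection onto countably many
coordinates, which may be chosen in any uncountable set of coordinates. -/
lemma IsLindelof.exists_countable_ne {A : Type*} {Z : Set (A → ℝ)} (hZ : IsLindelof Z)
    {J : Set A} (hJ : ¬ J.Countable) :
    ∃ L ⊆ J, L.Countable ∧ ∃ p : A → ℝ, ∀ z ∈ Z, ∃ a ∈ L, z a ≠ p a := by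
  let ι := {q : J × J // q.1 ≠ q.2}
  obtain ⟨r, hr, hcov⟩ := hZ.elim_countable_subcover
    (fun q : ι ↦ {x : A → ℝ | |x q.1.1 - x q.1.2| < 1})
    (fun q ↦ isOpen_lt (by fun_prop) continuous_const) (by
      intro z _
      have : ¬ Function.Injective fun a : J ↦ ⌊z a⌋ := fun hinj ↦
        hJ (countable_coe_iff.1 hinj.countable)
      simp only [Function.Injective, not_forall] at this
      obtain ⟨a, b, hab, hne⟩ := this
      exact mem_iUnion.2 ⟨⟨(a, b), hne⟩, Int.abs_sub_lt_one_of_floor_eq_floor hab⟩)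
  let L : Set A := ⋃ q ∈ r, {(q.1.1 : A), (q.1.2 : A)}
  have hL : L.Countable := hr.biUnion fun q _ ↦ (toFinite _).countable
  obtain ⟨f, hf⟩ := countable_iff_exists_injOn.1 hL
  refine ⟨L, ?_, hL, fun a ↦ f a, fun z hz ↦ ?_⟩
  · refine iUnion₂_subset fun q _ ↦ ?_
    rintro a (rfl | rfl)
    exacts [q.1.1.2, q.1.2.2]
  · by_contra! hcon
    obtain ⟨q, hq, hzq⟩ := mem_iUnion₂.1 (hcov hz)
    have h1 : (q.1.1 : A) ∈ L := mem_iUnion₂.2 ⟨q, hq, by simp⟩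
    have h2 : (q.1.2 : A) ∈ L := mem_iUnion₂.2 ⟨q, hq, by simp⟩
    rw [mem_ofPred_eq, hcon _ h1, hcon _ h2] at hzq
    have h3 : |((f q.1.1 : ℤ) - (f q.1.2 : ℤ) : ℤ)| < 1 := by exact_mod_cast hzq
    rw [Int.abs_lt_one_iff, sub_eq_zero] at h3
    exact q.2 (Subtype.ext (hf h1 h2 (by exact_mod_cast h3)))

/-- Over a C-embedded Lindelöf set, a fresh countable block of coordinates can be rescaled by a
fresh coordinate `s` in such a way that `s` becomes bounded above by a continuous function of the
other coordinates. -/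
lemma exists_block {A : Type*} {Z : Set (A → ℝ)} (hZ : IsLindelof Z) (hZC : CEmbedded Z)
    {U : Set A} (hU : ¬ (Uᶜ).Countable) :
    ∃ (L D : Set A) (s u : A) (p : A → ℝ) (ν : (A → ℝ) → ℝ),
      L.Countable ∧ D.Countable ∧ L ⊆ Uᶜ ∧ s ∉ U ∧ u ∉ U ∧ s ≠ u ∧ s ∉ L ∧ u ∉ L ∧
      s ∉ D ∧ u ∉ D ∧ Continuous ν ∧ (∀ x y, EqOn x y D → ν x = ν y) ∧
      ∀ z ∈ Z, ∀ x : A → ℝ, (∀ a ∈ L, x a = Real.exp (z s) * (z a - p a)) →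
        (∀ a ∉ L, x a = z a) → z s ≤ ν x := by
  classical
  obtain ⟨L, hLU, hL, p, hp⟩ := hZ.exists_countable_ne hU
  have : Countable L := hL.to_subtype
  let _ : MetricSpace (L → ℝ) := TopologicalSpace.metrizableSpaceMetric (L → ℝ)
  let G : (A → ℝ) → ℝ := fun x ↦ dist (fun a : L ↦ x a) (fun a : L ↦ p a)
  have hG : Continuous G := by
    have : Continuous fun (x : A → ℝ) (a : L) ↦ x a := continuous_pi fun a ↦ continuous_apply _
    exact this.dist continuous_const
  have hGz : ∀ z ∈ Z, G z ≠ 0 := fun z hz h0 ↦ by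
    obtain ⟨a, ha, hne⟩ := hp z hz
    exact hne (congr_fun (dist_eq_zero.1 h0) ⟨a, ha⟩)
  obtain ⟨f, hf, hfZ⟩ := hZC (fun z ↦ (G z)⁻¹)
    ((hG.comp continuous_subtype_val).inv₀ fun z ↦ hGz z z.2)
  let φ : (A → ℝ) → ℝ := fun x ↦ f x * G x
  have hφ : Continuous φ := hf.mul hG
  have hφZ : ∀ z ∈ Z, φ z = 1 := fun z hz ↦ by
    simp only [φ, hfZ ⟨z, hz⟩, inv_mul_cancel₀ (hGz z hz)]
  obtain ⟨D, hD, hφD⟩ := hφ.exists_countable_eqOn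
  have hinf : (Uᶜ \ (L ∪ D)).Infinite := fun hfin ↦ hU <|
    (hfin.countable.union (hL.union hD)).mono fun a ha ↦ by
      by_cases h : a ∈ L ∪ D
      exacts [Or.inr h, Or.inl ⟨ha, h⟩]
  obtain ⟨s, hs⟩ := hinf.nonempty
  obtain ⟨u, hu, hus⟩ := hinf.exists_notMem_finset {s}
  simp only [mem_sdiff, mem_compl_iff, mem_union, not_or] at hs hu
  let sub : (A → ℝ) → ℝ → A → ℝ := fun x t a ↦ if a ∈ L then p a + t * x a else x a
  let q : (A → ℝ) → ℝ → ℝ := fun x t ↦ t + |1 - φ (sub x t)|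
  have hsub : Continuous fun w : (A → ℝ) × ℝ ↦ sub w.1 w.2 := by
    refine continuous_pi fun a ↦ ?_
    by_cases ha : a ∈ L <;> simp only [sub, ha, if_true, if_false] <;> fun_prop
  have hq : Continuous fun w : (A → ℝ) × ℝ ↦ q w.1 w.2 :=
    continuous_snd.add (continuous_const.sub (hφ.comp hsub)).abs
  let d : (A → ℝ) → ℝ := fun x ↦ sInf (q x '' Icc 0 1)
  have hd : Continuous d := isCompact_Icc.continuous_sInf hq
  have hq0 : ∀ x, q x 0 = 1 := fun x ↦ by
    have : φ (sub x 0) = 0 := by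
      have : G (sub x 0) = 0 := by
        refine dist_eq_zero.2 (funext fun a ↦ ?_)
        simp [sub]
      simp [φ, this]
    simp [q, this]
  have hqc : ∀ x, Continuous (q x) := fun x ↦ hq.comp (by fun_prop : Continuous fun t ↦ (x, t))
  have hle : ∀ x, ∀ t ∈ Icc (0 : ℝ) 1, d x ≤ q x t := fun x t ht ↦
    csInf_le (isCompact_Icc.image (hqc x)).bddBelow (mem_image_of_mem _ ht)
  have hdpos : ∀ x, 0 < d x := fun x ↦ by
    obtain ⟨t, ht, hdt⟩ := (isCompact_Icc.image (hqc x)).sInf_mem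
      ((nonempty_Icc.2 zero_le_one).image (q x))
    change q x t = d x at hdt
    rw [← hdt]
    rcases ht.1.eq_or_lt with rfl | h0
    · rw [hq0]; exact one_pos
    · exact add_pos_of_pos_of_nonneg h0 (abs_nonneg _)
  refine ⟨L, D, s, u, p, fun x ↦ -Real.log (d x), hL, hD, hLU, hs.1, hu.1, ?_, hs.2.1, hu.2.1,
    hs.2.2, hu.2.2, (hd.log fun x ↦ (hdpos x).ne').neg, ?_, ?_⟩
  · rintro rfl
    simp at hus
  · intro x y hxy
    have : q x = q y := funext fun t ↦ by
      have : φ (sub x t) = φ (sub y t) := hφD _ _ fun a ha ↦ by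
        simp only [sub, hxy ha]
      simp only [q, this]
    simp only [d, this]
  · intro z hz x hxL hx
    have hxz : sub x (Real.exp (-z s)) = z := funext fun a ↦ by
      by_cases ha : a ∈ L
      · simp only [sub, ha, if_true, hxL a ha, ← mul_assoc, ← Real.exp_add]
        simp
      · simp [sub, ha, hx a ha]
    have hdz : d x ≤ Real.exp (-z s) := by
      by_cases h1 : Real.exp (-z s) ≤ 1
      · refine (hle x _ ⟨(Real.exp_pos _).le, h1⟩).trans_eq ?_
        simp [q, hxz, hφZ z hz]
      · have := hle x 0 (by simp)
        rw [hq0] at this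
        exact this.trans (not_le.1 h1).le
    have := Real.log_le_log (hdpos x) hdz
    rw [Real.log_exp] at this
    simp only
    linarith

/-- A continuous self-map of `ℝ^A` which can be inverted coordinate by coordinate along a
well-founded relation on `A` is a homeomorphism. -/
lemma exists_homeomorph_of_wellFounded {A : Type*} {R : A → A → Prop} (hR : WellFounded R)
    {H : (A → ℝ) → A → ℝ} (hH : Continuous H) {I : (A → ℝ) → (A → ℝ) → A → ℝ}
    (hI : Continuous fun w : (A → ℝ) × (A → ℝ) ↦ I w.1 w.2)
    (hIR : ∀ a x x' y, (∀ b, R b a → x b = x' b) → I x y a = I x' y a)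
    (hIH : ∀ x, I x (H x) = x) (hHI : ∀ x y, I x y = x → H x = y) :
    ∃ e : (A → ℝ) ≃ₜ (A → ℝ), ⇑e = H := by
  classical
  let T : (A → ℝ) → A → ℝ := fun y ↦
    hR.fix fun a rec ↦ I (fun b ↦ if h : R b a then rec b h else 0) y a
  have hT : ∀ y a, T y a = I (fun b ↦ if R b a then T y b else 0) y a := fun y a ↦ by
    change hR.fix _ a = _
    rw [hR.fix_eq]
    simp only [dite_eq_ite, T]
  have hfix : ∀ y, I (T y) y = T y := fun y ↦ funext fun a ↦ by
    rw [hT]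
    exact hIR _ _ _ _ fun b hb ↦ (if_pos hb).symm
  have huniq : ∀ x y, I x y = x → x = T y := fun x y hx ↦ funext fun a ↦ by
    induction a using hR.induction with
    | _ a ih =>
      rw [← hx, ← hfix y]
      exact hIR _ _ _ _ ih
  have hTc : Continuous T := continuous_pi fun a ↦ by
    induction a using hR.induction with
    | _ a ih =>
      simp only [hT _ a]
      refine (continuous_apply a).comp (hI.comp (Continuous.prodMk (continuous_pi fun b ↦ ?_)
        continuous_id))
      by_cases hb : R b a
      · exact (ih b hb).congr fun y ↦ (if_pos hb).symm
      · exact continuous_const.congr fun y ↦ (if_neg hb).symm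
  exact ⟨⟨⟨H, T, fun x ↦ (huniq _ _ (hIH x)).symm, fun y ↦ hHI _ _ (hfix y)⟩, hH, hTc⟩, rfl⟩

/-- Glue functions given on disjoint blocks `L c ∪ {s c, u c}` and off these blocks. -/
lemma exists_glue {A C : Type*} {L : C → Set A} {s u : C → A}
    (hdisj : ∀ c c' a, (a ∈ L c ∨ a = s c ∨ a = u c) → (a ∈ L c' ∨ a = s c' ∨ a = u c') → c = c')
    (hsu : ∀ c, s c ≠ u c) (hsL : ∀ c, s c ∉ L c) (huL : ∀ c, u c ∉ L c)
    {X : Type*} [TopologicalSpace X] {vL : C → X → A → ℝ} {vs vu : C → X → ℝ} {v : X → A → ℝ}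
    (hvL : ∀ c, Continuous (vL c)) (hvs : ∀ c, Continuous (vs c)) (hvu : ∀ c, Continuous (vu c))
    (hv : Continuous v) :
    ∃ H : X → A → ℝ, Continuous H ∧ (∀ x c, ∀ a ∈ L c, H x a = vL c x a) ∧
      (∀ x c, H x (s c) = vs c x) ∧ (∀ x c, H x (u c) = vu c x) ∧
      ∀ x a, (∀ c, ¬ (a ∈ L c ∨ a = s c ∨ a = u c)) → H x a = v x a := by
  classical
  have key : ∀ a, ∃ g : X → ℝ, Continuous g ∧ (∀ c, a ∈ L c → ∀ x, g x = vL c x a) ∧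
      (∀ c, a = s c → ∀ x, g x = vs c x) ∧ (∀ c, a = u c → ∀ x, g x = vu c x) ∧
      ((∀ c, ¬ (a ∈ L c ∨ a = s c ∨ a = u c)) → ∀ x, g x = v x a) := by
    intro a
    by_cases ha : ∃ c, a ∈ L c ∨ a = s c ∨ a = u c
    · obtain ⟨c, hc⟩ := ha
      have heq : ∀ c', a ∈ L c' ∨ a = s c' ∨ a = u c' → c' = c := fun c' h ↦ hdisj _ _ _ h hc
      refine ⟨if a ∈ L c then fun x ↦ vL c x a else if a = s c then vs c else vu c, ?_, ?_, ?_, ?_,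
        fun h ↦ (h c hc).elim⟩
      · split_ifs
        exacts [(continuous_apply a).comp (hvL c), hvs c, hvu c]
      · intro c' h x
        obtain rfl := heq c' (.inl h)
        simp [h]
      · intro c' h x
        obtain rfl := heq c' (.inr (.inl h))
        simp [h, hsL]
      · intro c' h x
        obtain rfl := heq c' (.inr (.inr h))
        simp [h, huL, (hsu c').symm]
    · push Not at ha
      exact ⟨fun x ↦ v x a, (continuous_apply a).comp hv, fun c h ↦ ((ha c).1 h).elim,
        fun c h ↦ ((ha c).2.1 h).elim, fun c h ↦ ((ha c).2.2 h).elim, fun _ _ ↦ rfl⟩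
  choose g hg hgL hgs hgu hgv using key
  exact ⟨fun x a ↦ g a x, continuous_pi hg, fun x c a h ↦ hgL a c h x, fun x c ↦ hgs _ c rfl x,
    fun x c ↦ hgu _ c rfl x, fun x a h ↦ hgv a h x⟩

/-- A C-embedded Lindelöf subset of `ℝ^A` can be moved by a homeomorphism so that `|A|` many
coordinates become bounded on it. -/
lemma exists_homeomorph_bounded {A : Type u} (hA : Cardinal.aleph0 < Cardinal.mk A)
    {Z : Set (A → ℝ)} (hZ : IsLindelof Z) (hZC : CEmbedded Z) :
    ∃ (e : (A → ℝ) ≃ₜ (A → ℝ)) (u : A → A), Function.Injective u ∧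
      ∀ z ∈ Z, ∀ a, |e z (u a)| ≤ 1 := by
  classical
  let C := (Cardinal.mk A).ord.ToType
  have hblock : ∀ V : Set A, ∃ (L D : Set A) (s u : A) (p : A → ℝ) (ν : (A → ℝ) → ℝ),
      L.Countable ∧ D.Countable ∧ (¬ (Vᶜ).Countable →
      L ⊆ Vᶜ ∧ s ∉ V ∧ u ∉ V ∧ s ≠ u ∧ s ∉ L ∧ u ∉ L ∧
      s ∉ D ∧ u ∉ D ∧ Continuous ν ∧ (∀ x y, EqOn x y D → ν x = ν y) ∧
      ∀ z ∈ Z, ∀ x : A → ℝ, (∀ a ∈ L, x a = Real.exp (z s) * (z a - p a)) →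
        (∀ a ∉ L, x a = z a) → z s ≤ ν x) := by
    intro V
    by_cases hV : (Vᶜ).Countable
    · have : Nonempty A := Cardinal.mk_ne_zero_iff.1 (Cardinal.aleph0_pos.trans hA).ne'
      obtain ⟨a⟩ := this
      exact ⟨∅, ∅, a, a, 0, 0, countable_empty, countable_empty, fun h ↦ (h hV).elim⟩
    · obtain ⟨L, D, s, u, p, ν, hL, hD, h⟩ := exists_block hZ hZC hV
      exact ⟨L, D, s, u, p, ν, hL, hD, fun _ ↦ h⟩
  choose L₀ D₀ s₀ u₀ p₀ ν₀ hLc hDc hgood using hblock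
  let E : C → Set A := (wellFounded_lt (α := C)).fix fun c rec ↦
    let V : Set A := ⋃ (c') (h : c' < c), rec c' h
    L₀ V ∪ D₀ V ∪ {s₀ V, u₀ V}
  let U : C → Set A := fun c ↦ ⋃ (c') (_ : c' < c), E c'
  have hE : ∀ c, E c = L₀ (U c) ∪ D₀ (U c) ∪ {s₀ (U c), u₀ (U c)} := fun c ↦ by
    change (wellFounded_lt (α := C)).fix _ c = _
    rw [(wellFounded_lt (α := C)).fix_eq]
  have hEc : ∀ c, (E c).Countable := fun c ↦ by
    rw [hE]
    exact ((hLc _).union (hDc _)).union (toFinite _).countable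
  have hUc : ∀ c, ¬ ((U c)ᶜ).Countable := by
    intro c hc
    have h1 : Cardinal.mk (U c) < Cardinal.mk A := by
      have h2 : Cardinal.mk (U c) ≤ Cardinal.mk (Iio c) * Cardinal.aleph0 := by
        have : U c = ⋃ i : Iio c, E i := by
          simp only [U, iUnion_subtype, mem_Iio]
        rw [this]
        refine (Cardinal.mk_iUnion_le_sum_mk).trans ((Cardinal.sum_le_sum _
          (fun _ ↦ Cardinal.aleph0) fun i : Iio c ↦
            Cardinal.le_aleph0_iff_set_countable.2 (hEc i)).trans ?_)
        simp
      refine h2.trans_lt (Cardinal.mul_lt_of_lt hA.le ?_ hA)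
      simpa [C] using Cardinal.mk_Iio_lt c (by simp [C])
    have h3 := Cardinal.mk_sum_compl (U c)
    have h4 : Cardinal.mk ((U c)ᶜ : Set A) ≤ Cardinal.aleph0 :=
      Cardinal.le_aleph0_iff_set_countable.2 hc
    exact (Cardinal.add_lt_of_lt hA.le h1 (h4.trans_lt hA)).ne h3
  let L c := L₀ (U c)
  let D c := D₀ (U c)
  let s c := s₀ (U c)
  let u c := u₀ (U c)
  let p c := p₀ (U c)
  let ν c := ν₀ (U c)
  have hspec := fun c ↦ hgood (U c) (hUc c)
  have hTU : ∀ c a, (a ∈ L c ∨ a = s c ∨ a = u c) → a ∉ U c := by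
    rintro c a (h | rfl | rfl)
    exacts [(hspec c).1 h, (hspec c).2.1, (hspec c).2.2.1]
  have hEU : ∀ c c', c < c' → E c ⊆ U c' := fun c c' h a ha ↦ mem_iUnion₂.2 ⟨c, h, ha⟩
  have hTE : ∀ c a, (a ∈ L c ∨ a = s c ∨ a = u c) → a ∈ E c := by
    intro c a h
    rw [hE]
    rcases h with h | rfl | rfl
    exacts [.inl (.inl h), .inr (.inl rfl), .inr (.inr rfl)]
  have hDE : ∀ c, D c ⊆ E c := fun c a h ↦ by
    rw [hE]
    exact .inl (.inr h)
  have hUmono : ∀ c c', c ≤ c' → U c ⊆ U c' := fun c c' h a ha ↦ by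
    obtain ⟨d, hd, had⟩ := mem_iUnion₂.1 ha
    exact mem_iUnion₂.2 ⟨d, hd.trans_le h, had⟩
  have hdisj : ∀ c c' a, (a ∈ L c ∨ a = s c ∨ a = u c) → (a ∈ L c' ∨ a = s c' ∨ a = u c') →
      c = c' := by
    intro c c' a h h'
    rcases lt_trichotomy c c' with hlt | rfl | hlt
    · exact (hTU c' a h' (hEU _ _ hlt (hTE c a h))).elim
    · rfl
    · exact (hTU c a h (hEU _ _ hlt (hTE c' a h'))).elim
  have hsu : ∀ c, s c ≠ u c := fun c ↦ (hspec c).2.2.2.1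
  have hsL : ∀ c, s c ∉ L c := fun c ↦ (hspec c).2.2.2.2.1
  have huL : ∀ c, u c ∉ L c := fun c ↦ (hspec c).2.2.2.2.2.1
  have hsD : ∀ c, s c ∉ D c := fun c ↦ (hspec c).2.2.2.2.2.2.1
  have huD : ∀ c, u c ∉ D c := fun c ↦ (hspec c).2.2.2.2.2.2.2.1
  have hν : ∀ c, Continuous (ν c) := fun c ↦ (hspec c).2.2.2.2.2.2.2.2.1
  have hνD : ∀ c x y, EqOn x y (D c) → ν c x = ν c y := fun c ↦ (hspec c).2.2.2.2.2.2.2.2.2.1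
  have hνZ := fun c ↦ (hspec c).2.2.2.2.2.2.2.2.2.2
  -- a coordinate of `D c` outside `U c` lies in `L c` or in no block at all
  have hpass : ∀ c, ∀ b ∈ D c, b ∉ U c → b ∉ L c →
      ∀ c', ¬ (b ∈ L c' ∨ b = s c' ∨ b = u c') := by
    intro c b hb hbU hbL c' h
    rcases lt_trichotomy c c' with hlt | rfl | hlt
    · exact hTU c' b h (hEU _ _ hlt (hDE c hb))
    · rcases h with h | rfl | rfl
      exacts [hbL h, hsD c hb, huD c hb]
    · exact hbU (hEU _ _ hlt (hTE c' b h))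
  let Y : C → (A → ℝ) → A → ℝ := fun c x a ↦
    if a ∈ L c then Real.exp (x (s c)) * (x a - p c a) else x a
  have hY : ∀ c, Continuous (Y c) := fun c ↦ continuous_pi fun a ↦ by
    by_cases ha : a ∈ L c <;> simp only [Y, ha, if_true, if_false] <;> fun_prop
  let W : C → (A → ℝ) → ℝ := fun c x ↦ |x (u c)| - x (s c) + ν c (Y c x)
  have hW : ∀ c, Continuous (W c) := fun c ↦
    (by fun_prop : Continuous fun x : A → ℝ ↦ |x (u c)| - x (s c)).add ((hν c).comp (hY c))
  obtain ⟨H, hH, hHL, hHs, hHu, hHv⟩ := exists_glue hdisj hsu hsL huL hY hW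
    (vu := fun c x ↦ x (u c) / (1 + |W c x|))
    (fun c ↦ (continuous_apply _).div (continuous_const.add (hW c).abs) fun x ↦ by positivity)
    continuous_id
  let mix : C → (A → ℝ) × (A → ℝ) → A → ℝ := fun c w b ↦ if b ∈ U c then w.1 b else w.2 b
  have hmix : ∀ c, Continuous (mix c) := fun c ↦ continuous_pi fun a ↦ by
    by_cases ha : a ∈ U c <;> simp only [mix, ha, if_true, if_false] <;> fun_prop
  let S : C → (A → ℝ) × (A → ℝ) → ℝ := fun c w ↦
    |w.2 (u c) * (1 + |w.2 (s c)|)| + ν c (mix c w) - w.2 (s c)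
  have hS : ∀ c, Continuous (S c) := fun c ↦
    ((by fun_prop : Continuous fun w : (A → ℝ) × (A → ℝ) ↦
      |w.2 (u c) * (1 + |w.2 (s c)|)|).add ((hν c).comp (hmix c))).sub (by fun_prop)
  obtain ⟨I, hI, hIL, hIs, hIu, hIv⟩ := exists_glue hdisj hsu hsL huL
    (vL := fun c w a ↦ p c a + Real.exp (-S c w) * w.2 a)
    (vu := fun c w ↦ w.2 (u c) * (1 + |w.2 (s c)|))
    (fun c ↦ continuous_pi fun a ↦
      continuous_const.add ((Real.continuous_exp.comp (hS c).neg).mul (by fun_prop)))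
    hS (fun c ↦ by fun_prop) continuous_snd
  let R : A → A → Prop := fun b a ↦ ∃ c, (a ∈ L c ∨ a = s c ∨ a = u c) ∧ b ∈ U c
  have hRT : ∀ c, ∀ a, (a ∈ L c ∨ a = s c ∨ a = u c) → Acc R a := by
    intro c
    induction c using (wellFounded_lt (α := C)).induction with
    | _ c ih =>
      intro a ha
      refine ⟨_, ?_⟩
      rintro b ⟨c₁, hc₁, hb⟩
      obtain rfl := hdisj _ _ _ ha hc₁
      by_cases hbT : ∃ c', b ∈ L c' ∨ b = s c' ∨ b = u c'
      · obtain ⟨c', hc'⟩ := hbT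
        refine ih c' (lt_of_not_ge fun hle ↦ hTU c' b hc' (hUmono _ _ hle hb)) b hc'
      · refine ⟨_, ?_⟩
        rintro b' ⟨c', hc', -⟩
        exact (hbT ⟨c', hc'⟩).elim
  have hR : WellFounded R := ⟨fun a ↦ ⟨_, by
    rintro b ⟨c, -, -⟩
    by_cases hbT : ∃ c', b ∈ L c' ∨ b = s c' ∨ b = u c'
    · obtain ⟨c', hc'⟩ := hbT
      exact hRT c' b hc'
    · refine ⟨_, ?_⟩
      rintro b' ⟨c', hc', -⟩
      exact (hbT ⟨c', hc'⟩).elim⟩⟩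
  have ext4 : ∀ x y : A → ℝ, (∀ c, ∀ a ∈ L c, x a = y a) → (∀ c, x (s c) = y (s c)) →
      (∀ c, x (u c) = y (u c)) →
      (∀ a, (∀ c, ¬ (a ∈ L c ∨ a = s c ∨ a = u c)) → x a = y a) → x = y := by
    intro x y h1 h2 h3 h4
    ext a
    by_cases ha : ∃ c, a ∈ L c ∨ a = s c ∨ a = u c
    · obtain ⟨c, h | rfl | rfl⟩ := ha
      exacts [h1 c a h, h2 c, h3 c]
    · exact h4 a (not_exists.1 ha)
  obtain ⟨e, he⟩ := exists_homeomorph_of_wellFounded hR hH (I := fun x y ↦ I (x, y)) hI (by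
      intro a x x' y hxx
      by_cases ha : ∃ c, a ∈ L c ∨ a = s c ∨ a = u c
      · obtain ⟨c, hc⟩ := ha
        have hSS : S c (x, y) = S c (x', y) := by
          have : mix c (x, y) = mix c (x', y) := funext fun b ↦ by
            by_cases hb : b ∈ U c
            · simp [mix, hb, hxx b ⟨c, hc, hb⟩]
            · simp [mix, hb]
          simp only [S, this]
        rcases hc with h | rfl | rfl
        · simp only [hIL _ c a h, hSS]
        · simp only [hIs, hSS]
        · simp only [hIu]
      · rw [hIv _ _ (not_exists.1 ha), hIv _ _ (not_exists.1 ha)]) (by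
      intro x
      have hSx : ∀ c, S c (x, H x) = x (s c) := fun c ↦ by
        have h1 : ν c (mix c (x, H x)) = ν c (Y c x) := hνD c _ _ fun b hb ↦ by
          by_cases hbU : b ∈ U c
          · have : b ∉ L c := fun h ↦ hTU c b (.inl h) hbU
            simp [mix, Y, hbU, this]
          · by_cases hbL : b ∈ L c
            · simp [mix, hbU, hHL x c b hbL]
            · simp [mix, hbU, Y, hbL, hHv x b (hpass c b hb hbU hbL)]
        have h2 : 1 + |W c x| ≠ 0 := by positivity
        simp only [S, h1, hHs, hHu, div_mul_cancel₀ _ h2]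
        simp only [W]
        ring
      refine ext4 _ _ ?_ ?_ ?_ ?_
      · intro c a ha
        simp only [hIL _ c a ha, hSx, hHL x c a ha, Y, ha, if_true, ← mul_assoc, ← Real.exp_add]
        simp
      · intro c
        simp only [hIs, hSx]
      · intro c
        have h2 : 1 + |W c x| ≠ 0 := by positivity
        simp only [hIu, hHs, hHu, div_mul_cancel₀ _ h2]
      · intro a ha
        simp [hIv _ _ ha, hHv _ _ ha]) (by
      intro x y hxy
      have hxL : ∀ c, ∀ a ∈ L c, x a = p c a + Real.exp (-S c (x, y)) * y a := fun c a ha ↦ by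
        rw [← hIL _ c a ha, hxy]
      have hxs : ∀ c, x (s c) = S c (x, y) := fun c ↦ by rw [← hIs, hxy]
      have hxu : ∀ c, x (u c) = y (u c) * (1 + |y (s c)|) := fun c ↦ by rw [← hIu (x, y), hxy]
      have hxv : ∀ a, (∀ c, ¬ (a ∈ L c ∨ a = s c ∨ a = u c)) → x a = y a := fun a ha ↦ by
        have := hIv (x, y) a ha
        rwa [hxy] at this
      have hYL : ∀ c, ∀ a ∈ L c, Y c x a = y a := fun c a ha ↦ by
        simp only [Y, ha, if_true, hxs, hxL c a ha, add_sub_cancel_left, ← mul_assoc,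
          ← Real.exp_add]
        simp
      have hWy : ∀ c, W c x = y (s c) := fun c ↦ by
        have h1 : ν c (Y c x) = ν c (mix c (x, y)) := hνD c _ _ fun b hb ↦ by
          by_cases hbL : b ∈ L c
          · rw [hYL c b hbL]
            simp [mix, hTU c b (.inl hbL)]
          · by_cases hbU : b ∈ U c
            · simp [mix, Y, hbU, hbL]
            · simp [mix, Y, hbU, hbL, hxv b (hpass c b hb hbU hbL)]
        simp only [W, h1, hxu, hxs, S]
        ring
      refine ext4 _ _ ?_ ?_ ?_ ?_
      · intro c a ha
        rw [hHL _ c a ha, hYL c a ha]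
      · intro c
        rw [hHs, hWy]
      · intro c
        have h2 : 1 + |y (s c)| ≠ 0 := by positivity
        rw [hHu, hWy, hxu, mul_div_cancel_right₀ _ h2]
      · intro a ha
        rw [hHv _ _ ha, id, hxv a ha])
  obtain ⟨f⟩ : Nonempty (A ≃ C) := Cardinal.eq.1 (Cardinal.mk_ord_toType _).symm
  refine ⟨e, u ∘ f, ?_, ?_⟩
  · intro a b hab
    exact f.injective (hdisj _ _ _ (.inr (.inr rfl)) (.inr (.inr hab)))
  · intro z hz a
    have h1 : z (s (f a)) ≤ ν (f a) (Y (f a) z) :=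
      hνZ (f a) z hz _ (fun b hb ↦ if_pos hb) fun b hb ↦ if_neg hb
    have h2 : |z (u (f a))| ≤ |W (f a) z| := by
      refine le_trans ?_ (le_abs_self _)
      simp only [W]
      linarith
    rw [he, Function.comp, hHu, abs_div, abs_of_pos (by positivity : 0 < 1 + |W (f a) z|),
      div_le_one (by positivity)]
    linarith

/-- Some homeomorphism `ℝ^ℕ ≃ ℝ × ℝ^ℕ` sends the cube `[-1, 1]^ℕ` into `{0} × ℝ^ℕ`. -/
lemma exists_homeomorph_cube :
    ∃ K : (ℕ → ℝ) ≃ₜ ℝ × (ℕ → ℝ), ∀ y : ℕ → ℝ, (∀ n, |y n| ≤ 1) → (K y).1 = 0 := by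
  let φ : (ℕ → ℝ) → ℝ := fun b ↦ ∑' k, max (-2) (min 2 (b k)) * (1 / 2) ^ k
  have hsum : Summable fun k : ℕ ↦ (2 : ℝ) * (1 / 2) ^ k := summable_geometric_two.mul_left 2
  have hbound : ∀ (b : ℕ → ℝ) k, ‖max (-2) (min 2 (b k)) * (1 / 2 : ℝ) ^ k‖ ≤ 2 * (1 / 2) ^ k := by
    intro b k
    rw [norm_mul, Real.norm_eq_abs, Real.norm_of_nonneg (by positivity : (0 : ℝ) ≤ (1 / 2) ^ k)]
    gcongr
    exact abs_le.2 ⟨le_max_left _ _, max_le (by norm_num) (min_le_left _ _)⟩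
  have hφ : Continuous φ :=
    continuous_tsum (fun k ↦ by fun_prop) hsum fun k b ↦ hbound b k
  let β : (ℕ → ℝ) → ℕ → ℝ := fun y n ↦ y n - y (n + 1) / 2
  have hβ : Continuous β := by fun_prop
  let ρ : ℝ × (ℕ → ℝ) → ℕ → ℝ := fun w n ↦
    Nat.rec (w.1 + φ w.2) (fun n r ↦ 2 * (r - w.2 n)) n
  have hρs : ∀ w n, ρ w (n + 1) = 2 * (ρ w n - w.2 n) := fun _ _ ↦ rfl
  have hρ : Continuous ρ := continuous_pi fun n ↦ by
    induction n with
    | zero => exact continuous_fst.add (hφ.comp continuous_snd)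
    | succ n ih =>
      simp only [hρs]
      fun_prop
  have hβρ : ∀ w, β (ρ w) = w.2 := fun w ↦ funext fun n ↦ by
    simp only [β, hρs]
    ring
  refine ⟨⟨⟨fun y ↦ (y 0 - φ (β y), β y), ρ, fun y ↦ funext fun n ↦ ?_, fun w ↦ ?_⟩,
    ((continuous_apply 0).sub (hφ.comp hβ)).prodMk hβ, hρ⟩, fun y hy ↦ ?_⟩
  · induction n with
    | zero => exact sub_add_cancel _ _
    | succ n ih =>
      rw [hρs, ih]
      simp only [β]
      ring
  · refine Prod.ext ?_ (hβρ w)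
    change ρ w 0 - φ (β (ρ w)) = w.1
    rw [hβρ]
    exact add_sub_cancel_right _ _
  · change y 0 - φ (β y) = 0
    have hterm : ∀ k, max (-2) (min 2 (β y k)) = β y k := fun k ↦ by
      have h1 := abs_le.1 (hy k)
      have h2 := abs_le.1 (hy (k + 1))
      rw [min_eq_right, max_eq_right] <;> simp only [β] <;> linarith
    have hpart : ∀ n, ∑ k ∈ Finset.range n, max (-2) (min 2 (β y k)) * (1 / 2) ^ k =
        y 0 - y n * (1 / 2) ^ n := fun n ↦ by
      induction n with
      | zero => simp
      | succ n ih =>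
        rw [Finset.sum_range_succ, ih, hterm]
        simp only [β]
        ring
    have hzero : Filter.Tendsto (fun n ↦ y n * (1 / 2 : ℝ) ^ n) Filter.atTop (𝓝 0) := by
      refine squeeze_zero_norm (fun n ↦ ?_) (tendsto_pow_atTop_nhds_zero_of_lt_one
        (by norm_num : (0 : ℝ) ≤ 1 / 2) (by norm_num))
      rw [norm_mul, Real.norm_eq_abs, Real.norm_of_nonneg (by positivity : (0 : ℝ) ≤ (1 / 2) ^ n)]
      exact mul_le_of_le_one_left (by positivity) (hy n)
    have hlim := (Summable.of_norm_bounded hsum (hbound (β y))).hasSum.tendsto_sum_nat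
    simp only [hpart] at hlim
    have := tendsto_nhds_unique hlim (tendsto_const_nhds.sub hzero)
    simp only [φ, this, sub_zero, sub_self]

/-- A C-embedded Lindelöf subset of `ℝ^A` can be moved into `ℝ^A × {0} ⊆ ℝ^A × ℝ^A`. -/
lemma exists_homeomorph_deficient {A : Type u} (hA : Cardinal.aleph0 < Cardinal.mk A)
    {Z : Set (A → ℝ)} (hZ : IsLindelof Z) (hZC : CEmbedded Z) :
    ∃ T : (A → ℝ) ≃ₜ (A → ℝ) × (A → ℝ), ∀ z ∈ Z, (T z).2 = 0 := by
  classical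
  obtain ⟨e, u, hu, hbd⟩ := exists_homeomorph_bounded hA hZ hZC
  obtain ⟨K, hK⟩ := exists_homeomorph_cube
  obtain ⟨i⟩ : Nonempty (A × ℕ ≃ A) := Cardinal.eq.1 (by simp [hA.le])
  let v : A × ℕ → A := u ∘ i
  have hv : Function.Injective v := hu.comp i.injective
  let g : A ≃ ((range v)ᶜ : Set A) ⊕ (A × ℕ) :=
    ((Equiv.sumComm _ _).trans (((Equiv.ofInjective v hv).sumCongr (Equiv.refl _)).trans
      (Equiv.Set.sumCompl (range v)))).symm
  have hg : ∀ q, g.symm (.inr q) = v q := fun q ↦ by simp [g]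
  let reindex : (A → ℝ) ≃ₜ (((range v)ᶜ : Set A) ⊕ (A × ℕ) → ℝ) :=
    { toFun := fun x j ↦ x (g.symm j)
      invFun := fun x a ↦ x (g a)
      left_inv := fun x ↦ by simp
      right_inv := fun x ↦ by simp }
  let curry : (A × ℕ → ℝ) ≃ₜ (A → ℕ → ℝ) :=
    { toFun := fun x a n ↦ x (a, n)
      invFun := fun x q ↦ x q.1 q.2
      left_inv := fun _ ↦ rfl
      right_inv := fun _ ↦ rfl }
  let split : (A → ℝ × (ℕ → ℝ)) ≃ₜ (A × ℕ → ℝ) × (A → ℝ) :=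
    { toFun := fun x ↦ (fun q ↦ (x q.1).2 q.2, fun a ↦ (x a).1)
      invFun := fun w a ↦ (w.2 a, fun n ↦ w.1 (a, n))
      left_inv := fun _ ↦ rfl
      right_inv := fun _ ↦ rfl }
  let T : (A → ℝ) ≃ₜ (A → ℝ) × (A → ℝ) :=
    (((e.trans reindex).trans Homeomorph.sumArrowHomeomorphProdArrow).trans
      ((Homeomorph.refl _).prodCongr ((curry.trans (Homeomorph.piCongrRight fun _ ↦ K)).trans
        split))).trans ((Homeomorph.prodAssoc _ _ _).symm.trans
          ((Homeomorph.sumArrowHomeomorphProdArrow.symm.trans reindex.symm).prodCongr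
            (Homeomorph.refl _)))
  refine ⟨T, fun z hz ↦ funext fun a ↦ hK (fun n ↦ e z (g.symm (.inr (a, n)))) fun n ↦ ?_⟩
  rw [hg]
  exact hbd z hz _

/-- The shear of `X × ℝ^A` along a continuous map. -/
def shear {X A : Type*} [TopologicalSpace X] (Φ : C(X, A → ℝ)) : X × (A → ℝ) ≃ₜ X × (A → ℝ) where
  toFun w := (w.1, w.2 + Φ w.1)
  invFun w := (w.1, w.2 - Φ w.1)
  left_inv w := by simp
  right_inv w := by simp

lemma CEmbedded.exists_extend {X A : Type*} [TopologicalSpace X] {Z : Set X} (hZ : CEmbedded Z)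
    {f : Z → A → ℝ} (hf : Continuous f) :
    ∃ g : X → A → ℝ, Continuous g ∧ ∀ z : Z, g z = f z := by
  choose g hg hgf using fun a ↦ hZ (fun z ↦ f z a) ((continuous_apply a).comp hf)
  exact ⟨fun x a ↦ g a x, continuous_pi hg, fun z ↦ funext fun a ↦ hgf a z⟩

/-- For `τ > ω`, any homeomorphism between closed, C-embedded, Lindelöf subsets of `ℝ^τ`
extends to an autohomeomorphism of `ℝ^τ`. -/
theorem lindelof_unknotting
    (τ : Cardinal.{u}) (hτ : Cardinal.aleph0 < τ)
    (A : Type u) (hA : Cardinal.mk A = τ)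
    (Z F : Set (A → ℝ)) (hZcl : IsClosed Z) (hFcl : IsClosed F)
    (hZC : CEmbedded Z) (hFC : CEmbedded F)
    (hZL : IsLindelof Z) (hFL : IsLindelof F)
    (h : ↥Z ≃ₜ ↥F) :
    ∃ H : (A → ℝ) ≃ₜ (A → ℝ),
      ∀ z : Z, H (z : A → ℝ) = (h z : A → ℝ) := by
  subst hA
  obtain ⟨S, hS⟩ := exists_homeomorph_deficient hτ hZL hZC
  obtain ⟨T, hT⟩ := exists_homeomorph_deficient hτ hFL hFC
  obtain ⟨f, hf, hfh⟩ := hZC.exists_extend (f := fun z ↦ (T (h z)).1) (by fun_prop)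
  obtain ⟨g, hg, hgh⟩ := hFC.exists_extend (f := fun w ↦ (S (h.symm w)).1) (by fun_prop)
  let Φ : C(A → ℝ, A → ℝ) := ⟨fun x ↦ f (S.symm (x, 0)), by fun_prop⟩
  let Ψ : C(A → ℝ, A → ℝ) := ⟨fun x ↦ g (T.symm (x, 0)), by fun_prop⟩
  refine ⟨(((S.trans (shear Φ)).trans (Homeomorph.prodComm _ _)).trans (shear Ψ).symm).trans T.symm,
    fun z ↦ ?_⟩
  have hSz : S z = ((S z).1, 0) := Prod.ext rfl (hS z z.2)
  have hTz : T (h z) = ((T (h z)).1, 0) := Prod.ext rfl (hT _ (h z).2)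
  have hΦ : Φ (S z).1 = (T (h z)).1 := by
    change f (S.symm ((S z).1, 0)) = _
    rw [← hSz, S.symm_apply_apply, hfh]
  have hΨ : Ψ (T (h z)).1 = (S z).1 := by
    change g (T.symm ((T (h z)).1, 0)) = _
    rw [← hTz, T.symm_apply_apply, hgh, h.symm_apply_apply]
  change T.symm ((S z).2 + Φ (S z).1, (S z).1 - Ψ ((S z).2 + Φ (S z).1)) = _
  rw [hS z z.2, zero_add, hΦ, hΨ, sub_self, ← hTz, T.symm_apply_apply]
end
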